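/- arXiv:math/0312416 — 5 statements merged into one kernel-verified Lean document; each statement's English description precedes it below -/
import Mathlib

section
/- Let σ be the ℂ-algebra automorphism of ℂ[w,u,v] determined by σ(w) = w, σ(u) = i·u, σ(v) = i·v. Then the subalgebra of σ-fixed elements of ℂ[w,u,v] equals the ℂ-subalgebra generated by the six polynomials w, v⁴, v³u, v²u², vu³, u⁴. -/
open MvPolynomial

theorem MvPolynomial.monomial_fin_three {R : Type*} [CommSemiring R] (d : Fin 3 →₀ ℕ) (a : R) :
    monomial d a = C a * (X 0 ^ d 0 * X 1 ^ d 1 * X 2 ^ d 2) := by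
  rw [monomial_eq, Finsupp.prod_fintype _ _ (fun _ => pow_zero _), Fin.prod_univ_three]

/-- An algebra endomorphism scaling the last two variables by `c` acts diagonally on
coefficients. -/
theorem MvPolynomial.coeff_map_of_scale {R : Type*} [CommSemiring R] (c : R)
    (f : MvPolynomial (Fin 3) R →ₐ[R] MvPolynomial (Fin 3) R)
    (h0 : f (X 0) = X 0) (h1 : f (X 1) = C c * X 1) (h2 : f (X 2) = C c * X 2)
    (d : Fin 3 →₀ ℕ) (p : MvPolynomial (Fin 3) R) :
    coeff d (f p) = c ^ (d 1 + d 2) * coeff d p := by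
  induction p using MvPolynomial.induction_on' with
  | monomial e a =>
    have h : f (monomial e a) = C (c ^ (e 1 + e 2)) * monomial e a := by
      rw [monomial_fin_three]
      simp only [map_mul, map_pow, h0, h1, h2, algHom_C, algebraMap_eq]
      ring
    rw [h, coeff_C_mul, coeff_monomial]
    split_ifs with hed
    · rw [hed]
    · simp
  | add p q hp hq => rw [map_add, coeff_add, coeff_add, hp, hq, mul_add]

/-- A subalgebra containing all degree four monomials in `x` and `y` contains all monomials
in `x` and `y` of degree divisible by four. -/
theorem Subalgebra.pow_mul_pow_mem_of_four_dvd {R A : Type*} [CommSemiring R]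
    [CommSemiring A] [Algebra R A] (S : Subalgebra R A) {x y : A} (h40 : y ^ 4 ∈ S)
    (h31 : y ^ 3 * x ∈ S) (h22 : y ^ 2 * x ^ 2 ∈ S) (h13 : y * x ^ 3 ∈ S)
    (h04 : x ^ 4 ∈ S) {a b : ℕ} (hab : 4 ∣ a + b) :
    x ^ a * y ^ b ∈ S := by
  have key : x ^ (a % 4) * y ^ (b % 4) ∈ S := by
    have hr : a % 4 = 0 ∧ b % 4 = 0 ∨ a % 4 = 1 ∧ b % 4 = 3 ∨
        a % 4 = 2 ∧ b % 4 = 2 ∨ a % 4 = 3 ∧ b % 4 = 1 := by omega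
    rcases hr with ⟨ha, hb⟩ | ⟨ha, hb⟩ | ⟨ha, hb⟩ | ⟨ha, hb⟩ <;> rw [ha, hb]
    · simp [S.one_mem]
    · simpa [mul_comm] using h31
    · simpa [mul_comm] using h22
    · simpa [mul_comm] using h13
  have h : x ^ a * y ^ b =
      (x ^ 4) ^ (a / 4) * (y ^ 4) ^ (b / 4) * (x ^ (a % 4) * y ^ (b % 4)) := by
    rw [mul_mul_mul_comm, ← pow_mul, ← pow_mul, ← pow_add, ← pow_add,
      Nat.div_add_mod, Nat.div_add_mod]
  rw [h]
  exact S.mul_mem (S.mul_mem (S.pow_mem h04 _) (S.pow_mem h40 _)) key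

/-- Let `σ` be the ℂ-algebra automorphism of `ℂ[w,u,v]` (with `w = X 0`, `u = X 1`,
`v = X 2`) determined by `σ(w) = w`, `σ(u) = i·u`, `σ(v) = i·v`.  Then the fixed
subalgebra of `σ` equals the ℂ-subalgebra generated by `w, v⁴, v³u, v²u², vu³, u⁴`. -/
theorem fixed_subalgebra_diag_1_i_i
    (σ : MvPolynomial (Fin 3) ℂ ≃ₐ[ℂ] MvPolynomial (Fin 3) ℂ)
    (hw : σ (X 0) = X 0)
    (hu : σ (X 1) = C Complex.I * X 1)
    (hv : σ (X 2) = C Complex.I * X 2) :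
    ∀ p : MvPolynomial (Fin 3) ℂ, σ p = p ↔
      p ∈ Algebra.adjoin ℂ
        ({X 0, X 2 ^ 4, X 2 ^ 3 * X 1, X 2 ^ 2 * X 1 ^ 2, X 2 * X 1 ^ 3, X 1 ^ 4} :
          Set (MvPolynomial (Fin 3) ℂ)) := by
  intro p
  constructor
  · intro hp
    rw [p.as_sum]
    refine Subalgebra.sum_mem _ fun d hd => ?_
    have hcoeff := coeff_map_of_scale Complex.I (σ : _ →ₐ[ℂ] _) hw hu hv d p
    rw [AlgEquiv.coe_toAlgHom, hp] at hcoeff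
    have hpow : Complex.I ^ (d 1 + d 2) = 1 :=
      (mul_eq_right₀ (mem_support_iff.mp hd)).mp hcoeff.symm
    have hdvd : 4 ∣ d 1 + d 2 := Complex.isPrimitiveRoot_I.dvd_of_pow_eq_one _ hpow
    rw [monomial_fin_three, mul_assoc (X 0 ^ d 0)]
    refine Subalgebra.mul_mem _ (Subalgebra.algebraMap_mem _ _) (Subalgebra.mul_mem _
      (Subalgebra.pow_mem _ (Algebra.subset_adjoin (by simp)) _) ?_)
    refine Subalgebra.pow_mul_pow_mem_of_four_dvd _ ?_ ?_ ?_ ?_ ?_ hdvd <;>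
    exact Algebra.subset_adjoin (by simp)
  · intro hp
    have hC : (C Complex.I : MvPolynomial (Fin 3) ℂ) ^ 4 = 1 := by
      rw [← map_pow, Complex.I_pow_four, map_one]
    induction hp using Algebra.adjoin_induction with
    | mem x hx =>
      rcases hx with rfl | rfl | rfl | rfl | rfl | rfl
      · exact hw
      all_goals simp only [map_mul, map_pow, hu, hv]
      · linear_combination (X 2 ^ 4) * hC
      · linear_combination (X 2 ^ 3 * X 1) * hC
      · linear_combination (X 2 ^ 2 * X 1 ^ 2) * hC
      · linear_combination (X 2 * X 1 ^ 3) * hC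
      · linear_combination (X 1 ^ 4) * hC
    | algebraMap r => exact σ.commutes r
    | add x y _ _ hx hy => rw [map_add, hx, hy]
    | mul x y _ _ hx hy => rw [map_mul, hx, hy]
end

section
/- Let σ be the ℂ-algebra automorphism of ℂ[w,u,v] determined by σ(w) = w, σ(u) = i·u, σ(v) = −i·v. Then the subalgebra of σ-fixed elements of ℂ[w,u,v] equals the ℂ-subalgebra generated by the four polynomials w, v⁴, uv, u⁴. -/
open MvPolynomial

/-- A diagonal algebra endomorphism scales the coefficient at `d` by `∏ i, a i ^ d i`. -/
theorem MvPolynomial.coeff_of_map_X_eq_C_mul_X {ι R : Type*} [CommSemiring R]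
    (φ : MvPolynomial ι R →ₐ[R] MvPolynomial ι R) (a : ι → R)
    (hφ : ∀ i, φ (X i) = C (a i) * X i) (d : ι →₀ ℕ) (p : MvPolynomial ι R) :
    coeff d (φ p) = (d.prod fun i n => a i ^ n) * coeff d p := by
  have key : ∀ (e : ι →₀ ℕ) (r : R),
      φ (monomial e r) = monomial e ((e.prod fun i n => a i ^ n) * r) := by
    intro e r
    have h : φ (monomial e r) = C r * e.prod fun i n => φ (X i) ^ n := by
      rw [monomial_eq, map_mul, Finsupp.prod, Finsupp.prod, map_prod]
      simp [← algebraMap_eq]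
    rw [h, monomial_eq]
    simp only [hφ, mul_pow, Finset.prod_mul_distrib, map_mul, Finsupp.prod, map_prod, map_pow]
    ring
  induction p using MvPolynomial.induction_on' with
  | monomial e r =>
    classical
    rw [key, coeff_monomial, coeff_monomial]
    split_ifs with h
    · rw [h]
    · simp
  | add p q hp hq => rw [map_add, coeff_add, coeff_add, hp, hq, mul_add]

/-- The character `(m, n) ↦ I ^ m * (-I) ^ n` is trivial only when `m ≡ n [MOD 4]`. -/
theorem Complex.modEq_four_of_I_pow_mul_neg_I_pow_eq_one {m n : ℕ}
    (h : Complex.I ^ m * (-Complex.I) ^ n = 1) : m ≡ n [MOD 4] := by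
  have hI : -Complex.I = Complex.I ^ 3 := by rw [Complex.I_pow_three]
  rw [hI, ← pow_mul, ← pow_add] at h
  have hdvd := Complex.isPrimitiveRoot_I.dvd_of_pow_eq_one _ h
  unfold Nat.ModEq
  omega

/-- Let `σ` be the ℂ-algebra automorphism of `ℂ[w,u,v]` (with `w = X 0`, `u = X 1`,
`v = X 2`) determined by `σ(w) = w`, `σ(u) = i·u`, `σ(v) = −i·v`.  Then the fixed
subalgebra of `σ` equals the ℂ-subalgebra generated by `w, v⁴, uv, u⁴`. -/
theorem fixed_subalgebra_diag_1_i_negi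
    (σ : MvPolynomial (Fin 3) ℂ ≃ₐ[ℂ] MvPolynomial (Fin 3) ℂ)
    (hw : σ (X 0) = X 0)
    (hu : σ (X 1) = C Complex.I * X 1)
    (hv : σ (X 2) = -(C Complex.I) * X 2) :
    ∀ p : MvPolynomial (Fin 3) ℂ, σ p = p ↔
      p ∈ Algebra.adjoin ℂ
        ({X 0, X 2 ^ 4, X 1 * X 2, X 1 ^ 4} : Set (MvPolynomial (Fin 3) ℂ)) := by
  intro p
  have hC4 : (C Complex.I : MvPolynomial (Fin 3) ℂ) ^ 4 = 1 := by
    rw [← map_pow, Complex.I_pow_four, map_one]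
  have hC2 : (C Complex.I : MvPolynomial (Fin 3) ℂ) * C Complex.I = -1 := by
    rw [← map_mul, Complex.I_mul_I, map_neg, map_one]
  constructor
  · intro hp
    set S := Algebra.adjoin ℂ
      ({X 0, X 2 ^ 4, X 1 * X 2, X 1 ^ 4} : Set (MvPolynomial (Fin 3) ℂ)) with hS
    have m0 : (X 0 : MvPolynomial (Fin 3) ℂ) ∈ S := Algebra.subset_adjoin (by simp)
    have mv : (X 2 ^ 4 : MvPolynomial (Fin 3) ℂ) ∈ S := Algebra.subset_adjoin (by simp)
    have muv : (X 1 * X 2 : MvPolynomial (Fin 3) ℂ) ∈ S := Algebra.subset_adjoin (by simp)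
    have mu : (X 1 ^ 4 : MvPolynomial (Fin 3) ℂ) ∈ S := Algebra.subset_adjoin (by simp)
    rw [p.as_sum]
    refine sum_mem fun d hd => ?_
    have hcoeff := coeff_of_map_X_eq_C_mul_X (σ : _ →ₐ[ℂ] _) ![1, Complex.I, -Complex.I]
      (by intro i; fin_cases i <;> simp [hw, hu, hv]) d p
    have hd' : coeff d p ≠ 0 := mem_support_iff.mp hd
    have hmod : d 1 ≡ d 2 [MOD 4] := by
      apply Complex.modEq_four_of_I_pow_mul_neg_I_pow_eq_one
      rw [AlgEquiv.coe_toAlgHom, hp, Finsupp.prod_fintype _ _ (by simp)] at hcoeff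
      simpa [Fin.prod_univ_three, hd'] using hcoeff
    rw [monomial_eq, ← algebraMap_eq, Finsupp.prod_fintype _ _ (by simp), Fin.prod_univ_three]
    refine mul_mem (S.algebraMap_mem _) ?_
    rcases le_total (d 1) (d 2) with hle | hle
    · obtain ⟨k, hk⟩ := (Nat.modEq_iff_dvd' hle).mp hmod
      have h2 : d 2 = d 1 + 4 * k := by omega
      rw [h2, pow_add, pow_mul, mul_assoc, ← mul_assoc (X 1 ^ d 1), ← mul_pow]
      exact mul_mem (pow_mem m0 _) (mul_mem (pow_mem muv _) (pow_mem mv _))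
    · obtain ⟨k, hk⟩ := (Nat.modEq_iff_dvd' hle).mp hmod.symm
      have h1 : d 1 = d 2 + 4 * k := by omega
      rw [h1, pow_add, pow_mul, mul_assoc, mul_right_comm, ← mul_pow]
      exact mul_mem (pow_mem m0 _) (mul_mem (pow_mem muv _) (pow_mem mu _))
  · intro hp
    induction hp using Algebra.adjoin_induction with
    | mem x hx =>
      rcases hx with rfl | rfl | rfl | rfl
      · exact hw
      · rw [map_pow, hv]
        linear_combination X 2 ^ 4 * hC4
      · rw [map_mul, hu, hv]
        linear_combination -(X 1 * X 2) * hC2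
      · rw [map_pow, hu]
        linear_combination X 1 ^ 4 * hC4
    | algebraMap r => exact σ.commutes r
    | add x y _ _ hx hy => rw [map_add, hx, hy]
    | mul x y _ _ hx hy => rw [map_mul, hx, hy]
end

section
/- Let σ be the ℂ-algebra automorphism of ℂ[w,u,v] determined by σ(w) = −w, σ(u) = i·u, σ(v) = −i·v. Then the subalgebra of σ-fixed elements of ℂ[w,u,v] equals the ℂ-subalgebra generated by the six polynomials v⁴, vu, u⁴, wu², wv², w². -/
open MvPolynomial

/-- A diagonal algebra endomorphism of a polynomial ring scales each coefficient by the
corresponding character value. -/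
theorem MvPolynomial.coeff_algHom_of_diagonal {ι R : Type*} [CommSemiring R] (s : ι → R)
    (f : MvPolynomial ι R →ₐ[R] MvPolynomial ι R) (hf : ∀ j, f (X j) = C (s j) * X j)
    (m : ι →₀ ℕ) (p : MvPolynomial ι R) :
    coeff m (f p) = (m.prod fun j k => s j ^ k) * coeff m p := by
  classical
  induction p using MvPolynomial.induction_on' with
  | monomial n a =>
    have h : f (monomial n a) = C (n.prod fun j k => s j ^ k) * monomial n a := by
      rw [monomial_eq, map_mul, algHom_C, algebraMap_eq, map_finsuppProd, map_finsuppProd,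
        mul_left_comm, ← Finsupp.prod_mul]
      simp [hf, mul_pow]
    rw [h, coeff_C_mul, coeff_monomial]
    split_ifs with hnm
    · rw [hnm]
    · simp
  | add p q hp hq => rw [map_add, coeff_add, coeff_add, hp, hq, mul_add]

/-- In a commutative algebra, a monomial `w ^ a * u ^ b * v ^ c` of weight `2a + b + 3c`
divisible by `4` lies in the subalgebra generated by `v⁴, vu, u⁴, wu², wv², w²`. -/
theorem monomial_mem_adjoin_of_four_dvd {R A : Type*} [CommSemiring R] [CommSemiring A]
    [Algebra R A] (w u v : A) {a b c : ℕ} (h : 4 ∣ 2 * a + b + 3 * c) :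
    w ^ a * u ^ b * v ^ c ∈
      Algebra.adjoin R ({v ^ 4, v * u, u ^ 4, w * u ^ 2, w * v ^ 2, w ^ 2} : Set A) := by
  set S := Algebra.adjoin R ({v ^ 4, v * u, u ^ 4, w * u ^ 2, w * v ^ 2, w ^ 2} : Set A)
  have hv4 : v ^ 4 ∈ S := Algebra.subset_adjoin (by simp)
  have hvu : v * u ∈ S := Algebra.subset_adjoin (by simp)
  have hu4 : u ^ 4 ∈ S := Algebra.subset_adjoin (by simp)
  have hwu : w * u ^ 2 ∈ S := Algebra.subset_adjoin (by simp)
  have hwv : w * v ^ 2 ∈ S := Algebra.subset_adjoin (by simp)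
  have hw2 : w ^ 2 ∈ S := Algebra.subset_adjoin (by simp)
  have key : ∀ x : A, x ^ 4 ∈ S → w * x ^ 2 ∈ S → ∀ k l n : ℕ, 2 ∣ k + l →
      w ^ k * x ^ (2 * l) * (v * u) ^ n ∈ S := by
    intro x hx4 hwx k l n hkl
    refine mul_mem ?_ (pow_mem hvu n)
    obtain ⟨r, rfl | rfl⟩ := k.even_or_odd'
    · obtain ⟨t, rfl⟩ : ∃ t, l = 2 * t := ⟨l / 2, by omega⟩
      convert mul_mem (pow_mem hw2 r) (pow_mem hx4 t) using 1
      ring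
    · obtain ⟨t, rfl⟩ : ∃ t, l = 2 * t + 1 := ⟨l / 2, by omega⟩
      convert mul_mem (mul_mem (pow_mem hw2 r) (pow_mem hx4 t)) hwx using 1
      ring
  rcases le_total b c with hbc | hbc
  · obtain ⟨e, rfl⟩ : ∃ e, c = b + 2 * e := ⟨(c - b) / 2, by omega⟩
    convert key v hv4 hwv a e b (by omega) using 1
    ring
  · obtain ⟨e, rfl⟩ : ∃ e, b = c + 2 * e := ⟨(b - c) / 2, by omega⟩
    convert key u hu4 hwu a e c (by omega) using 1
    ring

/-- Let `σ` be the ℂ-algebra automorphism of `ℂ[w,u,v]` (with `w = X 0`, `u = X 1`,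
`v = X 2`) determined by `σ(w) = −w`, `σ(u) = i·u`, `σ(v) = −i·v`.  Then the fixed
subalgebra of `σ` equals the ℂ-subalgebra generated by the six polynomials
`v⁴, vu, u⁴, wu², wv², w²`. -/
theorem fixed_subalgebra_diag_neg1_i_negi
    (σ : MvPolynomial (Fin 3) ℂ ≃ₐ[ℂ] MvPolynomial (Fin 3) ℂ)
    (hw : σ (X 0) = -X 0)
    (hu : σ (X 1) = C Complex.I * X 1)
    (hv : σ (X 2) = -(C Complex.I) * X 2) :
    ∀ p : MvPolynomial (Fin 3) ℂ, σ p = p ↔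
      p ∈ Algebra.adjoin ℂ
        ({X 2 ^ 4, X 2 * X 1, X 1 ^ 4, X 0 * X 1 ^ 2, X 0 * X 2 ^ 2, X 0 ^ 2} :
          Set (MvPolynomial (Fin 3) ℂ)) := by
  intro p
  constructor
  · intro hp
    rw [p.as_sum]
    refine sum_mem fun m hm => ?_
    have hcoeff := coeff_algHom_of_diagonal ![-1, Complex.I, -Complex.I] σ.toAlgHom
      (by intro j; fin_cases j <;> simp [hw, hu, hv]) m p
    have hχ : Complex.I ^ (2 * m 0 + m 1 + 3 * m 2) = 1 := by
      have hσ : σ.toAlgHom p = p := hp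
      rw [hσ, eq_comm, mul_eq_right₀ (mem_support_iff.mp hm),
        Finsupp.prod_fintype _ _ (by simp), Fin.prod_univ_three] at hcoeff
      rw [← hcoeff, pow_add, pow_add, pow_mul, pow_mul, Complex.I_sq, Complex.I_pow_three]
      simp
    have hdvd : 4 ∣ 2 * m 0 + m 1 + 3 * m 2 :=
      Complex.isPrimitiveRoot_I.dvd_of_pow_eq_one _ hχ
    rw [monomial_eq, ← algebraMap_eq, ← Algebra.smul_def,
      Finsupp.prod_fintype _ _ (by simp), Fin.prod_univ_three]
    exact Subalgebra.smul_mem _ (monomial_mem_adjoin_of_four_dvd _ _ _ hdvd) _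
  · intro hp
    have hI : (C Complex.I : MvPolynomial (Fin 3) ℂ) ^ 2 = -1 := by
      rw [← C_pow, Complex.I_sq, C_neg, C_1]
    have hle : Algebra.adjoin ℂ
        ({X 2 ^ 4, X 2 * X 1, X 1 ^ 4, X 0 * X 1 ^ 2, X 0 * X 2 ^ 2, X 0 ^ 2} :
          Set (MvPolynomial (Fin 3) ℂ)) ≤
        AlgHom.equalizer σ.toAlgHom (AlgHom.id ℂ (MvPolynomial (Fin 3) ℂ)) := by
      refine Algebra.adjoin_le ?_
      rintro x (rfl | rfl | rfl | rfl | rfl | rfl) <;>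
        simp [hw, hu, hv] <;> grind
    exact hle hp
end

section
/- Let f₅ = z(yz − x²)² − 2xy²(yz − x²) + y⁵ ∈ ℂ[x,y,z]. If (x,y,z) ∈ ℂ³ satisfies ∂f₅/∂x = ∂f₅/∂y = ∂f₅/∂z = 0 at (x,y,z), then either (x,y,z) = (0,0,0) or x = y = 0. Conversely, all three partial derivatives of f₅ vanish at (0,0,1). Hence [0:0:1] is the unique singular point of the projective quintic curve {f₅ = 0} ⊂ ℙ²(ℂ). -/
open MvPolynomial

/-- `f₅ = z(yz − x²)² − 2xy²(yz − x²) + y⁵`, with `x = X 0`, `y = X 1`, `z = X 2`. -/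
noncomputable def quinticF5 : MvPolynomial (Fin 3) ℂ :=
  X 2 * (X 1 * X 2 - X 0 ^ 2) ^ 2 - 2 * X 0 * X 1 ^ 2 * (X 1 * X 2 - X 0 ^ 2) + X 1 ^ 5

/-- The three partial derivatives of `f₅` in terms of `u = yz - x²`. -/
theorem eval_pderiv_quinticF5 (p : Fin 3 → ℂ) :
    eval p (pderiv 0 quinticF5) =
      -4 * p 0 * p 2 * (p 1 * p 2 - p 0 ^ 2) - 2 * p 1 ^ 2 * (p 1 * p 2 - p 0 ^ 2)
        + 4 * p 0 ^ 2 * p 1 ^ 2 ∧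
    eval p (pderiv 1 quinticF5) =
      2 * p 2 ^ 2 * (p 1 * p 2 - p 0 ^ 2) - 4 * p 0 * p 1 * (p 1 * p 2 - p 0 ^ 2)
        - 2 * p 0 * p 1 ^ 2 * p 2 + 5 * p 1 ^ 4 ∧
    eval p (pderiv 2 quinticF5) =
      (p 1 * p 2 - p 0 ^ 2) ^ 2 + 2 * p 1 * p 2 * (p 1 * p 2 - p 0 ^ 2)
        - 2 * p 0 * p 1 ^ 3 := by
  have h2 (i : Fin 3) : pderiv i (2 : MvPolynomial (Fin 3) ℂ) = 0 := by
    simpa using (pderiv i).map_natCast 2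
  refine ⟨?_, ?_, ?_⟩ <;>
    simp [quinticF5, pderiv_X, h2, Derivation.leibniz, Derivation.leibniz_pow] <;>
    ring

/-- Away from `y = 0` the partial derivatives of `f₅` have no common zero. -/
theorem eq_zero_of_quintic_partials_eq_zero {x y z : ℂ}
    (hx : -4 * x * z * (y * z - x ^ 2) - 2 * y ^ 2 * (y * z - x ^ 2) + 4 * x ^ 2 * y ^ 2 = 0)
    (hy : 2 * z ^ 2 * (y * z - x ^ 2) - 4 * x * y * (y * z - x ^ 2)
      - 2 * x * y ^ 2 * z + 5 * y ^ 4 = 0)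
    (hz : (y * z - x ^ 2) ^ 2 + 2 * y * z * (y * z - x ^ 2) - 2 * x * y ^ 3 = 0) :
    y = 0 := by
  obtain ⟨u, hu⟩ : ∃ u, u = y * z - x ^ 2 := ⟨_, rfl⟩
  rw [← hu] at hx hy hz
  have hprod : u * (x * u - y ^ 3) = 0 := by
    linear_combination y / 2 * hx + x * hz
  by_contra hy0
  have hu0 : u = 0 := by
    rcases mul_eq_zero.mp hprod with h | h
    · exact h
    · refine pow_eq_zero_iff two_ne_zero |>.mp ?_
      linear_combination (1 / 3 : ℂ) * hz + (2 / 3 : ℂ) * u * hu - (2 / 3 : ℂ) * x * h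
  have hx0 : x = 0 := by
    have : x * y ^ 3 = 0 := by
      rw [hu0] at hz
      linear_combination (-1 / 2 : ℂ) * hz
    exact (mul_eq_zero.mp this).resolve_right (pow_ne_zero 3 hy0)
  have : y ^ 4 = 0 := by
    rw [hu0, hx0] at hy
    linear_combination (1 / 5 : ℂ) * hy
  exact pow_ne_zero 4 hy0 this

/-- If all three partial derivatives of `f₅ = z(yz − x²)² − 2xy²(yz − x²) + y⁵` vanish at
a point of `ℂ³`, then either the point is the origin or its first two coordinates vanish;
conversely all partial derivatives of `f₅` vanish at `(0,0,1)`.  Hence `[0:0:1]` is the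
unique singular point of the projective quintic `{f₅ = 0} ⊂ ℙ²(ℂ)`. -/
theorem quintic_unique_singular_point :
    (∀ p : Fin 3 → ℂ, (∀ i : Fin 3, eval p (pderiv i quinticF5) = 0) →
      p = 0 ∨ (p 0 = 0 ∧ p 1 = 0)) ∧
    (∀ i : Fin 3, eval (fun j : Fin 3 => if j = 2 then (1 : ℂ) else 0)
      (pderiv i quinticF5) = 0) := by
  refine ⟨fun p hp => Or.inr ?_, fun i => ?_⟩
  · obtain ⟨hx, hy, hz⟩ := eval_pderiv_quinticF5 p
    rw [hp] at hx hy hz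
    have hy0 : p 1 = 0 := eq_zero_of_quintic_partials_eq_zero hx.symm hy.symm hz.symm
    refine ⟨?_, hy0⟩
    rw [hy0] at hz
    refine pow_eq_zero_iff four_ne_zero |>.mp ?_
    linear_combination -hz
  · obtain ⟨hx, hy, hz⟩ := eval_pderiv_quinticF5 (fun j : Fin 3 => if j = 2 then (1 : ℂ) else 0)
    fin_cases i
    · exact hx.trans (by simp)
    · exact hy.trans (by simp)
    · exact hz.trans (by simp)
end

section
/- The homogeneous quintic polynomial f₅ = z(yz − x²)² − 2xy²(yz − x²) + y⁵ is irreducible in ℂ[x,y,z]; equivalently, the projective plane curve C = {f₅ = 0} ⊂ ℙ²(ℂ) is irreducible. -/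
open MvPolynomial

/-- The polynomial `z(z - x²)² - 2x(z - x²) + 1` is irreducible in `K[x][z]`. -/
theorem irreducible_dehomogenized_quintic {K : Type*} [Field K] :
    Irreducible
      ((Polynomial.X : Polynomial (Polynomial K))
          * (Polynomial.X - Polynomial.C Polynomial.X ^ 2) ^ 2
        - 2 * Polynomial.C Polynomial.X * (Polynomial.X - Polynomial.C Polynomial.X ^ 2) + 1) := by
  set f := ((Polynomial.X : Polynomial (Polynomial K))
      * (Polynomial.X - Polynomial.C Polynomial.X ^ 2) ^ 2
    - 2 * Polynomial.C Polynomial.X * (Polynomial.X - Polynomial.C Polynomial.X ^ 2) + 1) with hf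
  have hcubic : f = Polynomial.X ^ 3 + Polynomial.C (-2 * Polynomial.X ^ 2) * Polynomial.X ^ 2
      + Polynomial.C (Polynomial.X ^ 4 - 2 * Polynomial.X) * Polynomial.X
      + Polynomial.C (2 * Polynomial.X ^ 3 + 1) := by
    simp only [hf, map_add, map_sub, map_mul, map_pow, map_neg, map_one, map_ofNat]
    ring
  have hdeg : f.natDegree = 3 := by rw [hcubic]; compute_degree!
  have hmonic : f.Monic := by rw [hcubic]; monicity!
  rw [hmonic.irreducible_iff_roots_eq_zero_of_degree_le_three (by omega) (by omega),
    Multiset.eq_zero_iff_forall_notMem]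
  intro p hp
  have hroot := Polynomial.isRoot_of_mem_roots hp
  simp only [hf, Polynomial.IsRoot.def, Polynomial.eval_add, Polynomial.eval_sub,
    Polynomial.eval_mul, Polynomial.eval_pow, Polynomial.eval_X, Polynomial.eval_C,
    Polynomial.eval_one, Polynomial.eval_ofNat] at hroot
  have hunit : IsUnit (p - Polynomial.X ^ 2) :=
    IsUnit.of_mul_eq_one (2 * Polynomial.X - p * (p - Polynomial.X ^ 2))
      (by linear_combination -hroot)
  obtain ⟨c, hc, hcp⟩ := Polynomial.isUnit_iff.mp hunit
  have hp' : p = Polynomial.C c + Polynomial.X ^ 2 := by rw [hcp]; ring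
  rw [hp'] at hroot
  have hzero : Polynomial.C (c ^ 2) * Polynomial.X ^ 2 + Polynomial.C (-2 * c) * Polynomial.X
      + Polynomial.C (c ^ 3 + 1) = 0 := by
    simp only [map_add, map_mul, map_pow, map_neg, map_one, map_ofNat]
    linear_combination hroot
  have hcoeff := congrArg (Polynomial.coeff · 2) hzero
  have hc2 : c ^ 2 = 0 := by
    simpa only [Polynomial.coeff_add, Polynomial.coeff_C_mul, Polynomial.coeff_X_pow_self,
      Polynomial.coeff_X_of_ne_one (show 2 ≠ 1 by decide),
      Polynomial.coeff_C_of_ne_zero (show 2 ≠ 0 by decide), Polynomial.coeff_zero, mul_one, mul_zero,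
      add_zero] using hcoeff
  exact hc.ne_zero (pow_eq_zero_iff two_ne_zero |>.mp hc2)

/-- A polynomial `f` is irreducible when its image under some algebra map to `K[x][z]` is, provided
that specializing the image further to `K[x]` preserves the total degree of `f`. -/
theorem MvPolynomial.irreducible_of_irreducible_aeval {σ K : Type*} [Field K]
    {f : MvPolynomial σ K} (v : σ → Polynomial (Polynomial K)) (a : Polynomial K)
    (hv : ∀ i, ((v i).eval a).natDegree ≤ 1)
    (hdeg : f.totalDegree ≤ ((aeval v f).eval a).natDegree)
    (hirr : Irreducible (aeval v f)) : Irreducible f := by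
  have hf0 : f ≠ 0 := by rintro rfl; simp at hirr
  have hbound (p : MvPolynomial σ K) : ((aeval v p).eval a).natDegree ≤ p.totalDegree := by
    have h : (aeval v p).eval a = aeval (fun i => (v i).eval a) p := by
      induction p using MvPolynomial.induction_on with
      | C r => simp [Polynomial.algebraMap_apply]
      | add p q hp hq => simp [hp, hq]
      | mul_X p i hp => simp [hp]
    rw [h]
    simpa using aeval_natDegree_le p le_rfl _ hv
  have key (g h : MvPolynomial σ K) (hgh : f = g * h) (hg : IsUnit (aeval v g)) : IsUnit g := by
    have hg0 : g ≠ 0 := by rintro rfl; simp [hgh] at hf0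
    have hh0 : h ≠ 0 := by rintro rfl; simp [hgh] at hf0
    have hga : IsUnit ((aeval v g).eval a) := hg.map (Polynomial.evalRingHom a)
    have hdeg' := hdeg
    rw [hgh, map_mul, Polynomial.eval_mul, totalDegree_mul_of_isDomain hg0 hh0] at hdeg'
    have h1 := Polynomial.natDegree_mul_le
      (p := (aeval v g).eval a) (q := (aeval v h).eval a)
    have h2 := Polynomial.natDegree_eq_zero_of_isUnit hga
    have h3 := hbound h
    have hgd : g.totalDegree = 0 := by omega
    rw [totalDegree_eq_zero_iff_eq_C] at hgd
    rw [hgd] at hg0 ⊢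
    exact (isUnit_iff_ne_zero.mpr fun h => hg0 (by rw [h, C_0])).map C
  refine ⟨fun hu => hirr.not_isUnit (hu.map _), fun g h hgh => ?_⟩
  have hmap : aeval v f = aeval v g * aeval v h := by rw [hgh, map_mul]
  exact (hirr.isUnit_or_isUnit hmap).imp (key g h hgh) (key h g (hgh.trans (mul_comm g h)))

/-- The homogeneous quintic `f₅ = z(yz − x²)² − 2xy²(yz − x²) + y⁵` is irreducible in
`ℂ[x,y,z]` (with `x = X 0`, `y = X 1`, `z = X 2`); equivalently, the projective plane
curve `{f₅ = 0} ⊂ ℙ²(ℂ)` is irreducible. -/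
theorem quinticF5_irreducible :
    Irreducible
      (X 2 * (X 1 * X 2 - X 0 ^ 2) ^ 2 - 2 * X 0 * X 1 ^ 2 * (X 1 * X 2 - X 0 ^ 2)
        + X 1 ^ 5 : MvPolynomial (Fin 3) ℂ) := by
  have hX (i : Fin 3) : (X i : MvPolynomial (Fin 3) ℂ).IsHomogeneous 1 := isHomogeneous_X ℂ i
  have hconic : (X 1 * X 2 - X 0 ^ 2 : MvPolynomial (Fin 3) ℂ).IsHomogeneous 2 :=
    ((hX 1).mul (hX 2)).sub ((hX 0).pow 2)
  have htwo : (2 : MvPolynomial (Fin 3) ℂ).IsHomogeneous 0 := isHomogeneous_C (Fin 3) (2 : ℂ)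
  have hquintic := (((hX 2).mul (hconic.pow 2)).sub
    (((htwo.mul (hX 0)).mul ((hX 1).pow 2)).mul hconic)).add ((hX 1).pow 5)
  refine MvPolynomial.irreducible_of_irreducible_aeval
    ![Polynomial.C Polynomial.X, 1, Polynomial.X] Polynomial.X ?_ ?_ ?_
  · intro i
    fin_cases i <;> simp
  · refine hquintic.totalDegree_le.trans ?_
    have h : (Polynomial.X * (Polynomial.X - Polynomial.X ^ 2) ^ 2
        - 2 * Polynomial.X * (Polynomial.X - Polynomial.X ^ 2) + 1 : Polynomial ℂ).natDegree
        = 5 := by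
      have : (Polynomial.X * (Polynomial.X - Polynomial.X ^ 2) ^ 2
        - 2 * Polynomial.X * (Polynomial.X - Polynomial.X ^ 2) + 1 : Polynomial ℂ)
        = Polynomial.X ^ 5 - 2 * Polynomial.X ^ 4 + 3 * Polynomial.X ^ 3
          - 2 * Polynomial.X ^ 2 + 1 := by ring
      rw [this]
      compute_degree!
    simp [h]
  · simpa using irreducible_dehomogenized_quintic (K := ℂ)
end
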